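/- arXiv:1403.6913 — 7 statements merged into one kernel-verified Lean document; each statement's English description precedes it below -/
import Mathlib

section
/- Let D be a nonempty compact subset of X(A), and define the submultiplicative seminorm ρ_D on A by ρ_D(a) = sup_{α∈D} |α(a)|. Then an algebra homomorphism α ∈ X(A) is continuous with respect to the topology induced by ρ_D if and only if α ∈ D; equivalently, the Gelfand spectrum of (A, ρ_D) equals D. -/
/-!
Setting: `A` is a commutative unital `ℝ`-algebra.
`X(A)` is formalized as `A →ₐ[ℝ] ℝ`, with the topology induced from the
product topology on `A → ℝ`.
-/

/-- A cone of `A`: closed under addition and under scalar multiplication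
by nonnegative reals. -/
def IsCone {A : Type*} [CommRing A] [Algebra ℝ A] (C : Set A) : Prop :=
  (∀ x ∈ C, ∀ y ∈ C, x + y ∈ C) ∧ ∀ r : ℝ, 0 ≤ r → ∀ x ∈ C, r • x ∈ C

/-- A quadratic module of `A`: a cone containing `0` and `1`, closed under
multiplication by squares. -/
def IsQuadraticModule {A : Type*} [CommRing A] [Algebra ℝ A] (M : Set A) : Prop :=
  IsCone M ∧ (0 : A) ∈ M ∧ (1 : A) ∈ M ∧ ∀ a : A, ∀ m ∈ M, a ^ 2 * m ∈ M

/-- A cone `C` is Archimedean if for every `a ∈ A` there is a real `r ≥ 0`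
with `r + a ∈ C` and `r - a ∈ C`. -/
def IsArchimedeanCone {A : Type*} [CommRing A] [Algebra ℝ A] (C : Set A) : Prop :=
  ∀ a : A, ∃ r : ℝ, 0 ≤ r ∧ algebraMap ℝ A r + a ∈ C ∧ algebraMap ℝ A r - a ∈ C

/-- The seminorm `‖a‖_M = inf {r ∈ ℝ : r + a ∈ M and r - a ∈ M}` associated with
an (Archimedean) quadratic module `M`. -/
noncomputable def mNorm {A : Type*} [CommRing A] [Algebra ℝ A] (M : Set A) (a : A) : ℝ :=
  sInf {r : ℝ | algebraMap ℝ A r + a ∈ M ∧ algebraMap ℝ A r - a ∈ M}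

/-- The topology on `A` induced by a seminorm `ρ`, generated by the open balls. -/
def seminormTopology {A : Type*} [CommRing A] [Algebra ℝ A] (ρ : A → ℝ) :
    TopologicalSpace A :=
  TopologicalSpace.generateFrom
    {U : Set A | ∃ a : A, ∃ ε : ℝ, 0 < ε ∧ U = {x : A | ρ (x - a) < ε}}

/-- The topology on the real character space `X(A) = A →ₐ[ℝ] ℝ`, induced from the
product topology on `ℝ^A`. -/
noncomputable instance XATop {A : Type*} [CommRing A] [Algebra ℝ A] :
    TopologicalSpace (A →ₐ[ℝ] ℝ) :=
  TopologicalSpace.induced (fun α => (α : A → ℝ)) Pi.topologicalSpace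

section

variable {A : Type*} [CommRing A] [Algebra ℝ A]

theorem continuous_eval_character (a : A) : Continuous fun β : A →ₐ[ℝ] ℝ => β a :=
  (continuous_apply a).comp continuous_induced_dom

theorem IsCompact.bddAbove_abs_eval {D : Set (A →ₐ[ℝ] ℝ)} (hD : IsCompact D) (a : A) :
    BddAbove (Set.range fun β : D => |(β : A →ₐ[ℝ] ℝ) a|) := by
  have h := hD.bddAbove_image (continuous_eval_character a).abs.continuousOn
  rwa [Set.image_eq_range] at h

/-- Every open neighbourhood of a point in the topology of a seminorm contains a ball around it. -/
theorem exists_ball_subset_of_isOpen_seminormTopology {ρ : A → ℝ}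
    (hρ : ∀ a b, ρ (a + b) ≤ ρ a + ρ b) {U : Set A}
    (hU : @IsOpen A (seminormTopology ρ) U) {x : A} (hx : x ∈ U) :
    ∃ ε : ℝ, 0 < ε ∧ ∀ y, ρ (y - x) < ε → y ∈ U := by
  induction hU with
  | basic s hs =>
    obtain ⟨a, ε, -, rfl⟩ := hs
    refine ⟨ε - ρ (x - a), sub_pos.2 hx, fun y hy => ?_⟩
    have h := hρ (y - x) (x - a)
    rw [sub_add_sub_cancel] at h
    change ρ (y - a) < ε
    linarith
  | univ => exact ⟨1, one_pos, fun _ _ => trivial⟩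
  | inter s t _ _ ihs iht =>
    obtain ⟨ε, hε, h⟩ := ihs hx.1
    obtain ⟨δ, hδ, h'⟩ := iht hx.2
    exact ⟨min ε δ, lt_min hε hδ, fun y hy =>
      ⟨h y (hy.trans_le (min_le_left _ _)), h' y (hy.trans_le (min_le_right _ _))⟩⟩
  | sUnion S _ ih =>
    obtain ⟨t, ht, hxt⟩ := hx
    obtain ⟨ε, hε, h⟩ := ih t ht hxt
    exact ⟨ε, hε, fun y hy => ⟨t, ht, h y hy⟩⟩

theorem AlgHom.continuous_seminormTopology {ρ : A → ℝ} (hρ : ρ 0 = 0) {α : A →ₐ[ℝ] ℝ}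
    (hα : ∀ a, |α a| ≤ ρ a) : @Continuous A ℝ (seminormTopology ρ) _ α := by
  let := seminormTopology ρ
  refine continuous_iff_continuousAt.2 fun x => Metric.tendsto_nhds.2 fun ε hε => ?_
  have hopen : IsOpen {y : A | ρ (y - x) < ε} :=
    TopologicalSpace.isOpen_generateFrom_of_mem ⟨x, ε, hε, rfl⟩
  have hx : x ∈ {y : A | ρ (y - x) < ε} := by simpa [hρ] using hε
  filter_upwards [hopen.mem_nhds hx] with y hy
  rw [Real.dist_eq, ← map_sub]
  exact (hα _).trans_lt hy

/-- A character outside a compact set `D` of characters is a zero of some element that is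
nonnegative at all characters and positive on `D`. -/
theorem IsCompact.exists_separating_of_notMem {D : Set (A →ₐ[ℝ] ℝ)} (hD : IsCompact D)
    {α : A →ₐ[ℝ] ℝ} (hα : α ∉ D) :
    ∃ b : A, α b = 0 ∧ (∀ β : A →ₐ[ℝ] ℝ, 0 ≤ β b) ∧ ∀ β ∈ D, 0 < β b := by
  refine hD.induction_on
    (p := fun s => ∃ b : A, α b = 0 ∧ (∀ β : A →ₐ[ℝ] ℝ, 0 ≤ β b) ∧ ∀ β ∈ s, 0 < β b)
    ⟨0, by simp⟩ ?_ ?_ ?_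
  · rintro s t hst ⟨b, h0, hb, ht⟩
    exact ⟨b, h0, hb, fun β hβ => ht β (hst hβ)⟩
  · rintro s t ⟨b, hb0, hb, hs⟩ ⟨c, hc0, hc, ht⟩
    refine ⟨b + c, by simp [hb0, hc0], fun β => ?_, fun β hβ => ?_⟩
    · simpa using add_nonneg (hb β) (hc β)
    · rw [map_add]
      rcases hβ with hβ | hβ
      · exact add_pos_of_pos_of_nonneg (hs β hβ) (hc β)
      · exact add_pos_of_nonneg_of_pos (hb β) (ht β hβ)
  · intro β hβ
    obtain ⟨a, ha⟩ : ∃ a, β a ≠ α a := by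
      by_contra! h
      exact hα (AlgHom.ext h ▸ hβ)
    have hval (γ : A →ₐ[ℝ] ℝ) : γ ((a - algebraMap ℝ A (α a)) ^ 2) = (γ a - α a) ^ 2 := by
      simp
    refine ⟨{γ | 0 < γ ((a - algebraMap ℝ A (α a)) ^ 2)}, mem_nhdsWithin_of_mem_nhds <|
      (isOpen_lt continuous_const (continuous_eval_character _)).mem_nhds ?_,
      (a - algebraMap ℝ A (α a)) ^ 2, by simp [hval], fun γ => ?_, fun γ hγ => hγ⟩
    · rw [Set.mem_ofPred_eq, hval]
      exact sq_pos_of_ne_zero (sub_ne_zero.2 ha)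
    · rw [hval]
      positivity

/-- A character outside a nonempty compact set `D` of characters takes the value `1` at some
element whose values on `D` are bounded away from `1` in absolute value. -/
theorem IsCompact.exists_eval_eq_one_of_notMem {D : Set (A →ₐ[ℝ] ℝ)} (hD : IsCompact D)
    (hne : D.Nonempty) {α : A →ₐ[ℝ] ℝ} (hα : α ∉ D) :
    ∃ c : A, α c = 1 ∧ ∃ q : ℝ, 0 ≤ q ∧ q < 1 ∧ ∀ β ∈ D, |β c| ≤ q := by
  obtain ⟨b, hb0, -, hb⟩ := hD.exists_separating_of_notMem hα
  have hcont := (continuous_eval_character b).continuousOn (s := D)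
  obtain ⟨μ, hμ, hmin⟩ := hD.exists_isMinOn hne hcont
  obtain ⟨ν, hν, hmax⟩ := hD.exists_isMaxOn hne hcont
  have hμ0 := hb μ hμ
  have hν0 := hb ν hν
  have hval (β : A →ₐ[ℝ] ℝ) : β (1 - (ν b)⁻¹ • b) = 1 - β b / ν b := by
    rw [map_sub, map_one, map_smul, smul_eq_mul, inv_mul_eq_div]
  refine ⟨1 - (ν b)⁻¹ • b, by simp [hb0], 1 - μ b / ν b,
    sub_nonneg.2 ((div_le_one hν0).2 (hmax hμ)), sub_lt_self _ (div_pos hμ0 hν0),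
    fun β hβ => ?_⟩
  rw [hval, abs_of_nonneg (sub_nonneg.2 ((div_le_one hν0).2 (hmax hβ)))]
  exact sub_le_sub_left (div_le_div_of_nonneg_right (hmin hβ) hν0.le) 1

end

/-- For a nonempty compact `D ⊆ X(A)` and the seminorm
`ρ_D(a) = sup_{α ∈ D} |α(a)|`, a character `α ∈ X(A)` is continuous with respect to
the `ρ_D`-topology if and only if `α ∈ D`; i.e. `Sp_{ρ_D}(A) = D`. -/
theorem gelfandSpectrum_of_compact_sup_seminorm {A : Type*} [CommRing A] [Algebra ℝ A]
    (D : Set (A →ₐ[ℝ] ℝ)) (hDne : D.Nonempty) (hDcpt : IsCompact D)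
    (α : A →ₐ[ℝ] ℝ) :
    @Continuous A ℝ
        (seminormTopology (fun a => ⨆ β : D, |(β : A →ₐ[ℝ] ℝ) a|)) _ ⇑α
      ↔ α ∈ D := by
  have hbdd := hDcpt.bddAbove_abs_eval
  have : Nonempty D := hDne.to_subtype
  constructor
  · intro hcont
    by_contra hα
    obtain ⟨c, hc, q, hq0, hq1, hq⟩ := hDcpt.exists_eval_eq_one_of_notMem hDne hα
    have hadd (a b : A) : (⨆ β : D, |(β : A →ₐ[ℝ] ℝ) (a + b)|) ≤
        (⨆ β : D, |(β : A →ₐ[ℝ] ℝ) a|) + ⨆ β : D, |(β : A →ₐ[ℝ] ℝ) b| :=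
      ciSup_le fun β => by
        rw [map_add]
        exact (abs_add_le _ _).trans (add_le_add (le_ciSup (hbdd a) β) (le_ciSup (hbdd b) β))
    obtain ⟨ε, hε, hball⟩ := exists_ball_subset_of_isOpen_seminormTopology hadd
      (@IsOpen.preimage A ℝ (seminormTopology _) _ _ hcont _ (isOpen_Iio (a := 1)))
      (x := 0) (by simp)
    obtain ⟨n, hn⟩ := exists_pow_lt_of_lt_one hε hq1
    have hsup : (⨆ β : D, |(β : A →ₐ[ℝ] ℝ) (c ^ n - 0)|) ≤ q ^ n := ciSup_le fun β => by
      rw [sub_zero, map_pow, abs_pow]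
      exact pow_le_pow_left₀ (abs_nonneg _) (hq β β.2) n
    have := hball (c ^ n) (hsup.trans_lt hn)
    simp [hc] at this
  · intro hα
    exact α.continuous_seminormTopology (by simp) fun a => le_ciSup (hbdd a) ⟨α, hα⟩
end

section
/- Let X be a nonempty subset of X(A) and let T_X be the locally convex topology on A induced by the family of seminorms {ρ_D : D ⊆ X nonempty and compact}, where ρ_D(a) = sup_{α∈D} |α(a)|. Then the set of T_X-continuous elements of X(A) is exactly X; i.e., Sp_{T_X}(A) = X. -/
/-- The locally convex topology `T_X` on `A` induced by the family of sup-seminorms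
`ρ_D`, for `D` ranging over nonempty compact subsets of `X`.  (The topology induced
by a family of seminorms is the coarsest topology finer than each of the single
seminorm topologies, i.e. their infimum in the lattice of topologies.) -/
noncomputable def TX {A : Type*} [CommRing A] [Algebra ℝ A]
    (X : Set (A →ₐ[ℝ] ℝ)) : TopologicalSpace A :=
  ⨅ D ∈ {D : Set (A →ₐ[ℝ] ℝ) | D ⊆ X ∧ D.Nonempty ∧ IsCompact D},
    seminormTopology (fun a => ⨆ β : D, |(β : A →ₐ[ℝ] ℝ) a|)

theorem continuous_character_eval {A : Type*} [CommRing A] [Algebra ℝ A] (a : A) :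
    Continuous fun β : A →ₐ[ℝ] ℝ => β a :=
  (continuous_apply a).comp continuous_induced_dom

/-- The topology of uniform convergence on compact subsets of `X`, described by its open sets. -/
@[reducible] def uniformOnCompactsTopology {A : Type*} [CommRing A] [Algebra ℝ A]
    (X : Set (A →ₐ[ℝ] ℝ)) : TopologicalSpace A where
  IsOpen U := ∀ x ∈ U, ∃ D ⊆ X, IsCompact D ∧ ∃ δ : ℝ, 0 < δ ∧
    ∀ y, (∀ β ∈ D, |β (y - x)| ≤ δ) → y ∈ U
  isOpen_univ x _ :=
    ⟨∅, Set.empty_subset X, isCompact_empty, 1, one_pos, fun _ _ => Set.mem_univ _⟩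
  isOpen_inter U V hU hV x hx := by
    obtain ⟨D, hDX, hD, δ, hδ, hDU⟩ := hU x hx.1
    obtain ⟨E, hEX, hE, η, hη, hEV⟩ := hV x hx.2
    exact ⟨D ∪ E, Set.union_subset hDX hEX, hD.union hE, min δ η, lt_min hδ hη, fun y hy =>
      ⟨hDU y fun β hβ => (hy β (Or.inl hβ)).trans (min_le_left _ _),
        hEV y fun β hβ => (hy β (Or.inr hβ)).trans (min_le_right _ _)⟩⟩
  isOpen_sUnion S hS x hx := by
    obtain ⟨U, hU, hxU⟩ := hx
    obtain ⟨D, hDX, hD, δ, hδ, hDU⟩ := hS U hU x hxU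
    exact ⟨D, hDX, hD, δ, hδ, fun y hy => ⟨U, hU, hDU y hy⟩⟩

theorem uniformOnCompactsTopology_le_TX {A : Type*} [CommRing A] [Algebra ℝ A]
    (X : Set (A →ₐ[ℝ] ℝ)) : uniformOnCompactsTopology X ≤ TX X := by
  refine le_iInf₂ fun D hD => le_generateFrom ?_
  obtain ⟨hDX, hne, hc⟩ := hD
  rintro _ ⟨a, ε, -, rfl⟩ x hx
  have : Nonempty D := hne.to_subtype
  have hbdd : BddAbove (Set.range fun β : D => |(β : A →ₐ[ℝ] ℝ) (x - a)|) := by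
    have h := hc.bddAbove_image (continuous_character_eval (x - a)).abs.continuousOn
    rwa [Set.image_eq_range] at h
  simp only [Set.mem_ofPred_eq] at hx
  refine ⟨D, hDX, hc, (ε - ⨆ β : D, |(β : A →ₐ[ℝ] ℝ) (x - a)|) / 2, by linarith, fun y hy => ?_⟩
  refine lt_of_le_of_lt (b := (ε + ⨆ β : D, |(β : A →ₐ[ℝ] ℝ) (x - a)|) / 2)
    (ciSup_le fun β => ?_) (by linarith)
  have h₁ := le_ciSup hbdd β
  have h₂ := hy β β.2
  have h₃ := abs_add_le ((β : A →ₐ[ℝ] ℝ) (y - x)) ((β : A →ₐ[ℝ] ℝ) (x - a))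
  rw [← map_add, sub_add_sub_cancel] at h₃
  linarith

/-- A character outside a compact set `D` of characters vanishes at some element which is
positive on `D`. -/
theorem exists_eq_zero_forall_pos_of_notMem {A : Type*} [CommRing A] [Algebra ℝ A]
    {D : Set (A →ₐ[ℝ] ℝ)} (hD : IsCompact D) {α : A →ₐ[ℝ] ℝ} (hα : α ∉ D) :
    ∃ b : A, α b = 0 ∧ ∀ β ∈ D, 0 < β b := by
  have hsq (β : A →ₐ[ℝ] ℝ) (a : A) :
      β ((a - algebraMap ℝ A (α a)) ^ 2) = (β a - α a) ^ 2 := by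
    simp [AlgHom.commutes]
  obtain ⟨t, ht⟩ := hD.elim_finite_subcover (fun a : A => {β : A →ₐ[ℝ] ℝ | β a ≠ α a})
    (fun a => isOpen_ne_fun (continuous_character_eval a) continuous_const)
    (fun β hβ => by
      obtain ⟨a, ha⟩ := DFunLike.ne_iff.1 (ne_of_mem_of_not_mem hβ hα)
      exact Set.mem_iUnion.2 ⟨a, ha⟩)
  refine ⟨∑ a ∈ t, (a - algebraMap ℝ A (α a)) ^ 2, ?_, fun β hβ => ?_⟩
  · rw [map_sum]
    simp only [hsq, sub_self, ne_eq, OfNat.ofNat_ne_zero, not_false_eq_true, zero_pow,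
      Finset.sum_const_zero]
  · obtain ⟨a, hat, ha⟩ := Set.mem_iUnion₂.1 (ht hβ)
    rw [map_sum]
    simp only [hsq]
    exact Finset.sum_pos' (fun _ _ => sq_nonneg _) ⟨a, hat, sq_pos_iff.2 (sub_ne_zero.2 ha)⟩

/-- A character outside a compact set `D` of characters takes the value `1` at some element
which is uniformly small on `D`. -/
theorem exists_eq_one_forall_abs_le_of_notMem {A : Type*} [CommRing A] [Algebra ℝ A]
    {D : Set (A →ₐ[ℝ] ℝ)} (hD : IsCompact D) {α : A →ₐ[ℝ] ℝ} (hα : α ∉ D)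
    {δ : ℝ} (hδ : 0 < δ) : ∃ x : A, α x = 1 ∧ ∀ β ∈ D, |β x| ≤ δ := by
  rcases D.eq_empty_or_nonempty with rfl | hne
  · exact ⟨1, map_one α, by simp⟩
  obtain ⟨b, hb, hpos⟩ := exists_eq_zero_forall_pos_of_notMem hD hα
  obtain ⟨β₀, hβ₀, hmin⟩ := hD.exists_isMinOn hne (continuous_character_eval b).continuousOn
  obtain ⟨β₁, hβ₁, hmax⟩ := hD.exists_isMaxOn hne (continuous_character_eval b).continuousOn
  have h₀ := hpos β₀ hβ₀
  have h₁ := hpos β₁ hβ₁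
  obtain ⟨n, hn⟩ := exists_pow_lt_of_lt_one hδ (sub_lt_self 1 (div_pos h₀ h₁))
  refine ⟨(1 - (β₁ b)⁻¹ • b) ^ n, by simp [hb], fun β hβ => ?_⟩
  have hle : β b / β₁ b ≤ 1 := (div_le_one h₁).2 (hmax hβ)
  have hge : β₀ b / β₁ b ≤ β b / β₁ b := div_le_div_of_nonneg_right (hmin hβ) h₁.le
  have heval : β ((1 - (β₁ b)⁻¹ • b) ^ n) = (1 - β b / β₁ b) ^ n := by
    simp [div_eq_inv_mul]
  rw [heval, abs_of_nonneg (pow_nonneg (by linarith) n)]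
  exact (pow_le_pow_left₀ (by linarith) (by linarith) n).trans hn.le

theorem continuous_TX_of_mem {A : Type*} [CommRing A] [Algebra ℝ A]
    {X : Set (A →ₐ[ℝ] ℝ)} {α : A →ₐ[ℝ] ℝ} (hα : α ∈ X) : @Continuous A ℝ (TX X) _ ⇑α := by
  refine continuous_le_dom (iInf₂_le {α} ⟨Set.singleton_subset_iff.2 hα,
    Set.singleton_nonempty α, isCompact_singleton⟩) ?_
  let := seminormTopology fun a : A => ⨆ β : ({α} : Set (A →ₐ[ℝ] ℝ)), |(β : A →ₐ[ℝ] ℝ) a|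
  refine continuous_def.2 fun U hU => isOpen_iff_mem_nhds.2 fun a ha => ?_
  obtain ⟨ε, hε, hball⟩ := Metric.isOpen_iff.1 hU (α a) ha
  refine Filter.mem_of_superset (IsOpen.mem_nhds
    (TopologicalSpace.isOpen_generateFrom_of_mem ⟨a, ε, hε, rfl⟩) (by simpa using hε))
    fun x hx => hball ?_
  simpa [Real.dist_eq] using hx

theorem mem_of_continuous_TX {A : Type*} [CommRing A] [Algebra ℝ A]
    {X : Set (A →ₐ[ℝ] ℝ)} {α : A →ₐ[ℝ] ℝ} (hα : @Continuous A ℝ (TX X) _ ⇑α) : α ∈ X := by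
  obtain ⟨D, hDX, hD, δ, hδ, h⟩ := uniformOnCompactsTopology_le_TX X _
    (@IsOpen.preimage _ _ (TX X) _ _ hα _ (Metric.isOpen_ball (x := (0 : ℝ)) (ε := 1)))
    0 (by simp)
  by_contra hαX
  obtain ⟨x, hx, hxD⟩ := exists_eq_one_forall_abs_le_of_notMem hD (fun hαD => hαX (hDX hαD)) hδ
  simpa [hx] using h x (by simpa using hxD)

/-- For a nonempty `X ⊆ X(A)`, the set of `T_X`-continuous
characters of `A` is exactly `X`; i.e. `Sp_{T_X}(A) = X`. -/
theorem gelfandSpectrum_TX {A : Type*} [CommRing A] [Algebra ℝ A]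
    (X : Set (A →ₐ[ℝ] ℝ)) (hX : X.Nonempty) :
    {α : A →ₐ[ℝ] ℝ | @Continuous A ℝ (TX X) _ ⇑α} = X :=
  Set.ext fun _ => ⟨mem_of_continuous_TX, continuous_TX_of_mem⟩
end

section
/- Let M be a quadratic module of A and let X be a nonempty subset of X(A). Let T_X be the locally convex topology on A induced by the family of seminorms {ρ_D : D ⊆ X nonempty and compact}, where ρ_D(a) = sup_{α∈D} |α(a)|. Then the closure of M in the topology T_X equals Pos(X ∩ K(M)). -/
section EvaluationTopology

variable {A : Type*} [CommRing A] [Algebra ℝ A]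

theorem continuous_eval_XA (a : A) : Continuous fun α : A →ₐ[ℝ] ℝ => α a :=
  (continuous_apply a).comp continuous_induced_dom

/-- Restriction of the elements of `A`, viewed as functions on characters, to `D`. -/
noncomputable def evalOn (D : Set (A →ₐ[ℝ] ℝ)) : A →ₐ[ℝ] C(D, ℝ) where
  toFun a := ⟨fun β => (β : A →ₐ[ℝ] ℝ) a, (continuous_eval_XA a).comp continuous_subtype_val⟩
  map_one' := by ext; simp
  map_mul' _ _ := by ext; simp
  map_zero' := by ext; simp
  map_add' _ _ := by ext; simp
  commutes' _ := by ext; simp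

@[simp]
theorem evalOn_apply (D : Set (A →ₐ[ℝ] ℝ)) (a : A) (β : D) :
    evalOn D a β = (β : A →ₐ[ℝ] ℝ) a := rfl

theorem denseRange_evalOn (D : Set (A →ₐ[ℝ] ℝ)) [CompactSpace D] : DenseRange (evalOn D) := by
  have hsep : (evalOn D).range.SeparatesPoints := by
    intro α β hαβ
    obtain ⟨a, ha⟩ : ∃ a, (α : A →ₐ[ℝ] ℝ) a ≠ (β : A →ₐ[ℝ] ℝ) a := by
      by_contra! h
      exact hαβ (Subtype.ext (AlgHom.ext h))
    exact ⟨evalOn D a, ⟨evalOn D a, ⟨a, rfl⟩, rfl⟩, ha⟩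
  have htop :=
    ContinuousMap.subalgebra_topologicalClosure_eq_top_of_separatesPoints _ hsep
  intro f
  have hf : f ∈ (evalOn D).range.topologicalClosure := htop ▸ Algebra.mem_top
  simpa [← SetLike.mem_coe, Subalgebra.topologicalClosure_coe] using hf

variable {M : Set A} {D : Set (A →ₐ[ℝ] ℝ)} {f g : C(D, ℝ)}

theorem add_mem_closure_evalOn [CompactSpace D] (hM : IsQuadraticModule M)
    (hf : f ∈ closure (evalOn D '' M)) (hg : g ∈ closure (evalOn D '' M)) :
    f + g ∈ closure (evalOn D '' M) := by
  refine map_mem_closure₂ continuous_add hf hg ?_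
  rintro _ ⟨x, hx, rfl⟩ _ ⟨y, hy, rfl⟩
  exact ⟨x + y, hM.1.1 x hx y hy, map_add _ _ _⟩

theorem sq_mul_mem_closure_evalOn [CompactSpace D] (hM : IsQuadraticModule M)
    (g : C(D, ℝ)) (hf : f ∈ closure (evalOn D '' M)) :
    g ^ 2 * f ∈ closure (evalOn D '' M) := by
  refine map_mem_closure₂ (f := fun g f : C(D, ℝ) => g ^ 2 * f) (by fun_prop)
    (denseRange_evalOn D g) hf ?_
  rintro _ ⟨x, rfl⟩ _ ⟨y, hy, rfl⟩
  exact ⟨x ^ 2 * y, hM.2.2.2 x y hy, by simp⟩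

theorem mul_mem_closure_evalOn [CompactSpace D] (hM : IsQuadraticModule M)
    (hg : 0 ≤ g) (hf : f ∈ closure (evalOn D '' M)) :
    g * f ∈ closure (evalOn D '' M) := by
  convert sq_mul_mem_closure_evalOn hM ⟨fun β => √(g β), by fun_prop⟩ hf using 2
  ext β
  exact (Real.sq_sqrt (hg β)).symm

theorem nonneg_mem_closure_evalOn [CompactSpace D] (hM : IsQuadraticModule M) (hg : 0 ≤ g) :
    g ∈ closure (evalOn D '' M) := by
  simpa using mul_mem_closure_evalOn hM hg (subset_closure ⟨1, hM.2.2.1, map_one _⟩)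

theorem exists_nonpos_mem_closure_evalOn_le [CompactSpace D] (hM : IsQuadraticModule M)
    (hf : ∀ β : D, f β ≤ 0 → ∃ m ∈ M, (β : A →ₐ[ℝ] ℝ) m < 0) :
    ∃ v ∈ closure (evalOn D '' M), v ≤ 0 ∧ v ≤ f := by
  have key : ∃ v ∈ closure (evalOn D '' M), v ≤ 0 ∧ ∀ β ∈ Set.univ, v β ≤ f β := by
    refine isCompact_univ.induction_on
      (p := fun U => ∃ v ∈ closure (evalOn D '' M), v ≤ 0 ∧ ∀ β ∈ U, v β ≤ f β) ?_ ?_ ?_ ?_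
    · exact ⟨0, nonneg_mem_closure_evalOn hM le_rfl, le_rfl, by simp⟩
    · rintro s t hst ⟨v, hv, hv0, hvf⟩
      exact ⟨v, hv, hv0, fun β hβ => hvf β (hst hβ)⟩
    · rintro s t ⟨v, hv, hv0, hvf⟩ ⟨w, hw, hw0, hwf⟩
      refine ⟨v + w, add_mem_closure_evalOn hM hv hw, add_nonpos hv0 hw0, ?_⟩
      intro β hβ
      have h1 : v β ≤ 0 := hv0 β
      have h2 : w β ≤ 0 := hw0 β
      rw [ContinuousMap.add_apply]
      rcases hβ with hβ | hβ
      · linarith [hvf β hβ]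
      · linarith [hwf β hβ]
    · intro β _
      rw [nhdsWithin_univ]
      suffices h : ∃ v ∈ closure (evalOn D '' M), v ≤ 0 ∧ v β < f β by
        obtain ⟨v, hv, hv0, hvf⟩ := h
        exact ⟨{γ | v γ < f γ}, (isOpen_lt v.continuous f.continuous).mem_nhds hvf,
          v, hv, hv0, fun γ hγ => le_of_lt hγ⟩
      by_cases hβ : 0 < f β
      · exact ⟨0, nonneg_mem_closure_evalOn hM le_rfl, le_rfl, hβ⟩
      obtain ⟨m, hm, hmβ⟩ := hf β (not_lt.mp hβ)
      obtain ⟨k, hk0, hk⟩ : ∃ k : ℝ, 0 ≤ k ∧ -f β < k * (β : A →ₐ[ℝ] ℝ) m ^ 2 := by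
        have hpos : 0 < (β : A →ₐ[ℝ] ℝ) m ^ 2 := sq_pos_of_neg hmβ
        have hfβ : 0 ≤ -f β := by linarith
        refine ⟨(-f β + 1) / (β : A →ₐ[ℝ] ℝ) m ^ 2, by positivity, ?_⟩
        rw [div_mul_cancel₀ _ hpos.ne']
        linarith
      let g : C(D, ℝ) := ⟨fun γ => k * max (-evalOn D m γ) 0, by fun_prop⟩
      have hg : 0 ≤ g := fun γ => mul_nonneg hk0 (le_max_right _ _)
      refine ⟨g * evalOn D m, mul_mem_closure_evalOn hM hg (subset_closure ⟨m, hm, rfl⟩), ?_, ?_⟩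
      · intro γ
        change k * max (-(γ : A →ₐ[ℝ] ℝ) m) 0 * (γ : A →ₐ[ℝ] ℝ) m ≤ 0
        rcases le_total ((γ : A →ₐ[ℝ] ℝ) m) 0 with h | h
        · exact mul_nonpos_of_nonneg_of_nonpos (hg γ) h
        · simp [h]
      · change k * max (-(β : A →ₐ[ℝ] ℝ) m) 0 * (β : A →ₐ[ℝ] ℝ) m < f β
        rw [max_eq_left (by linarith)]
        nlinarith
  obtain ⟨v, hv, hv0, hvf⟩ := key
  exact ⟨v, hv, hv0, fun β => hvf β (Set.mem_univ β)⟩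

/-- A function that is nonnegative on `D ∩ K(M)` is a uniform limit on `D` of elements of `M`. -/
theorem exists_mem_forall_abs_sub_le (hM : IsQuadraticModule M) (hD : IsCompact D) {a : A}
    (ha : ∀ α ∈ D, (∀ m ∈ M, 0 ≤ α m) → 0 ≤ α a) {ε : ℝ} (hε : 0 < ε) :
    ∃ m ∈ M, ∀ β ∈ D, |β (m - a)| ≤ ε := by
  have : CompactSpace D := isCompact_iff_compactSpace.mp hD
  have hadd (β : D) : evalOn D (a + algebraMap ℝ A (ε / 2)) β = (β : A →ₐ[ℝ] ℝ) a + ε / 2 := by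
    rw [evalOn_apply, map_add, AlgHom.commutes, Algebra.algebraMap_self_apply]
  obtain ⟨v, hv, -, hvf⟩ := exists_nonpos_mem_closure_evalOn_le (M := M)
      (f := evalOn D (a + algebraMap ℝ A (ε / 2))) hM (by
    intro β hβ
    by_contra! h
    have := ha β β.2 h
    rw [hadd] at hβ
    linarith)
  have hmem := add_mem_closure_evalOn hM hv (nonneg_mem_closure_evalOn hM (sub_nonneg.mpr hvf))
  rw [add_sub_cancel] at hmem
  obtain ⟨_, ⟨m, hm, rfl⟩, hdist⟩ := Metric.mem_closure_iff.mp hmem (ε / 2) (half_pos hε)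
  refine ⟨m, hm, fun β hβ => ?_⟩
  have h := (ContinuousMap.dist_apply_le_dist ⟨β, hβ⟩).trans_lt hdist
  rw [hadd, evalOn_apply, Real.dist_eq, abs_lt] at h
  rw [map_sub, abs_le]
  constructor <;> linarith [h.1, h.2]

theorem bddAbove_range_abs_eval (hD : IsCompact D) (a : A) :
    BddAbove (Set.range fun β : D => |(β : A →ₐ[ℝ] ℝ) a|) := by
  have := hD.bddAbove_image (continuous_eval_XA a).abs.continuousOn
  rwa [Set.image_eq_range] at this

/-- The topology of uniform convergence on compact subsets of `X`, described by neighborhoods. -/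
@[reducible]
def uniformOnCompacts (X : Set (A →ₐ[ℝ] ℝ)) : TopologicalSpace A where
  IsOpen U := ∀ a ∈ U, ∃ D ⊆ X, IsCompact D ∧ ∃ ε > 0, ∀ x, (∀ β ∈ D, |β (x - a)| ≤ ε) → x ∈ U
  isOpen_univ := fun _ _ =>
    ⟨∅, Set.empty_subset _, isCompact_empty, 1, one_pos, fun _ _ => Set.mem_univ _⟩
  isOpen_inter := by
    rintro U V hU hV a ⟨haU, haV⟩
    obtain ⟨D, hDX, hD, ε, hε, h⟩ := hU a haU
    obtain ⟨E, hEX, hE, δ, hδ, h'⟩ := hV a haV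
    refine ⟨D ∪ E, Set.union_subset hDX hEX, hD.union hE, min ε δ, lt_min hε hδ, ?_⟩
    intro x hx
    exact ⟨h x fun β hβ => (hx β (Or.inl hβ)).trans (min_le_left _ _),
      h' x fun β hβ => (hx β (Or.inr hβ)).trans (min_le_right _ _)⟩
  isOpen_sUnion := by
    rintro S hS a ⟨U, hU, haU⟩
    obtain ⟨D, hDX, hD, ε, hε, h⟩ := hS U hU a haU
    exact ⟨D, hDX, hD, ε, hε, fun x hx => ⟨U, hU, h x hx⟩⟩

theorem uniformOnCompacts_le_TX (X : Set (A →ₐ[ℝ] ℝ)) : uniformOnCompacts X ≤ TX X := by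
  refine le_iInf₂ fun D hD => le_generateFrom ?_
  obtain ⟨hDX, hne, hD⟩ := hD
  rintro _ ⟨a, ε, -, rfl⟩ b hb
  simp only [Set.mem_ofPred_eq] at hb
  refine ⟨D, hDX, hD, (ε - ⨆ β : D, |(β : A →ₐ[ℝ] ℝ) (b - a)|) / 2, by linarith, ?_⟩
  intro x hx
  have : Nonempty D := hne.to_subtype
  refine (ciSup_le fun β => ?_).trans_lt (add_div_two_lt_right.mpr hb)
  have h1 := hx β β.2
  have h2 := le_ciSup (bddAbove_range_abs_eval hD (b - a)) β
  have h3 := abs_add_le ((β : A →ₐ[ℝ] ℝ) (x - b)) ((β : A →ₐ[ℝ] ℝ) (b - a))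
  rw [← map_add, sub_add_sub_cancel] at h3
  linarith

theorem isOpen_TX_eval_lt {X : Set (A →ₐ[ℝ] ℝ)} {α : A →ₐ[ℝ] ℝ} (hα : α ∈ X) (a : A)
    {ε : ℝ} (hε : 0 < ε) : @IsOpen A (TX X) {x : A | |α (x - a)| < ε} := by
  have hle : TX X ≤ seminormTopology fun a => ⨆ β : ({α} : Set (A →ₐ[ℝ] ℝ)),
      |(β : A →ₐ[ℝ] ℝ) a| :=
    iInf₂_le {α} ⟨Set.singleton_subset_iff.mpr hα, Set.singleton_nonempty α, isCompact_singleton⟩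
  refine hle _ (TopologicalSpace.isOpen_generateFrom_of_mem ⟨a, ε, hε, ?_⟩)
  ext x
  simp [ciSup_unique]

end EvaluationTopology

/-- For a quadratic module `M` and a nonempty `X ⊆ X(A)`, the
closure of `M` in the topology `T_X` equals `Pos(X ∩ K(M))`. -/
theorem closure_TX_eq_pos {A : Type*} [CommRing A] [Algebra ℝ A]
    (M : Set A) (hM : IsQuadraticModule M)
    (X : Set (A →ₐ[ℝ] ℝ)) (hX : X.Nonempty) :
    @closure A (TX X) M
      = {a : A | ∀ α : A →ₐ[ℝ] ℝ, α ∈ X → (∀ m ∈ M, 0 ≤ α m) → 0 ≤ α a} := by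
  ext a
  rw [@mem_closure_iff A (TX X)]
  constructor
  · intro h α hα hαM
    by_contra! hneg
    obtain ⟨m, hma, hm⟩ := h _ (isOpen_TX_eval_lt hα a (neg_pos.mpr hneg)) (by simpa using hneg)
    rw [Set.mem_ofPred_eq, abs_lt] at hma
    have h1 := hma.2
    rw [map_sub] at h1
    linarith [hαM m hm]
  · intro ha U hU haU
    obtain ⟨D, hDX, hD, ε, hε, h⟩ := uniformOnCompacts_le_TX X U hU a haU
    obtain ⟨m, hm, hma⟩ :=
      exists_mem_forall_abs_sub_le hM hD (fun α hα => ha α (hDX hα)) hε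
    exact ⟨m, h m hma, hm⟩
end

section
/- Let F be a saturated family of submultiplicative seminorms on A (i.e., the pointwise maximum of any two members of F again belongs to F), let τ be the locally convex topology on A induced by F, and let M be a quadratic module of A. Then the closure of M in the topology τ equals Pos(Sp_τ(A) ∩ K(M)), where Sp_τ(A) is the set of τ-continuous elements of X(A). -/
/-- A seminorm on `A` (as a real vector space): absolutely homogeneous and
subadditive. -/
def IsSeminorm {A : Type*} [CommRing A] [Algebra ℝ A] (ρ : A → ℝ) : Prop :=
  (∀ (l : ℝ) (a : A), ρ (l • a) = |l| * ρ a) ∧ ∀ a b : A, ρ (a + b) ≤ ρ a + ρ b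

section ArchimedeanModule

theorem Submodule.mul_mem_of_mem_subsemiring {A : Type*} [CommRing A] {T : Subsemiring A}
    (Q : Submodule T A) {t x : A} (ht : t ∈ T)
    (hx : x ∈ Q) : t * x ∈ Q :=
  Q.smul_mem ⟨t, ht⟩ hx

theorem Submodule.mem_of_mem_subsemiring {A : Type*} [CommRing A] {T : Subsemiring A}
    {Q : Submodule T A} (h1 : (1 : A) ∈ Q) {t : A} (ht : t ∈ T) : t ∈ Q := by
  simpa using Q.mul_mem_of_mem_subsemiring ht h1

variable {A : Type*} [CommRing A] [Algebra ℝ A] {T : Subsemiring A}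

/-- A real constant in a proper module over a subsemiring containing the nonnegative reals is
nonnegative. -/
theorem nonneg_of_algebraMap_mem (hT : ∀ r : ℝ, 0 ≤ r → algebraMap ℝ A r ∈ T)
    {Q : Submodule T A} (hQ : (-1 : A) ∉ Q) {r : ℝ} (hr : algebraMap ℝ A r ∈ Q) : 0 ≤ r := by
  by_contra! h
  apply hQ
  have := Q.mul_mem_of_mem_subsemiring (hT (-r)⁻¹ (by rw [inv_nonneg]; linarith)) hr
  rwa [← map_mul, show (-r)⁻¹ * r = -1 by rw [inv_neg, neg_mul, inv_mul_cancel₀ h.ne], map_neg, map_one] at this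

/-- A maximal proper module over an Archimedean subsemiring defines a total preorder. -/
theorem mem_or_neg_mem_of_maximal (hT : ∀ r : ℝ, 0 ≤ r → algebraMap ℝ A r ∈ T)
    (harch : ∀ a : A, ∃ r : ℝ, 0 ≤ r ∧ algebraMap ℝ A r + a ∈ T)
    {Q : Submodule T A} (h1 : (1 : A) ∈ Q) (hQ : (-1 : A) ∉ Q)
    (hmax : ∀ Q' : Submodule T A, Q ≤ Q' → (-1 : A) ∉ Q' → Q' ≤ Q) (x : A) :
    x ∈ Q ∨ -x ∈ Q := by
  have key : ∀ y : A, y ∉ Q → ∃ q ∈ Q, ∃ t ∈ T, q + t * y = -1 := by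
    intro y hy
    have : (-1 : A) ∈ Q ⊔ Submodule.span T {y} := by
      by_contra h
      exact hy (hmax _ le_sup_left h
        ((le_sup_right : _ ≤ Q ⊔ Submodule.span T {y}) (Submodule.mem_span_singleton_self y)))
    obtain ⟨q, hq, z, hz, hqz⟩ := Submodule.mem_sup.1 this
    obtain ⟨t, rfl⟩ := Submodule.mem_span_singleton.1 hz
    exact ⟨q, hq, t, t.2, hqz⟩
  by_contra! h
  obtain ⟨q, hq, t, ht, e⟩ := key x h.1
  obtain ⟨q', hq', t', ht', e'⟩ := key (-x) h.2
  have hneg : -t ∈ Q := by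
    have h2 := Q.add_mem (Q.add_mem (Q.mul_mem_of_mem_subsemiring ht' hq)
      (Q.mul_mem_of_mem_subsemiring ht hq')) (Submodule.mem_of_mem_subsemiring h1 ht')
    rwa [show t' * q + t * q' + t' = -t by linear_combination t' * e + t * e'] at h2
  obtain ⟨r, hr, hrx⟩ := harch x
  apply hQ
  have h3 := Q.add_mem (Q.add_mem hq (Q.mul_mem_of_mem_subsemiring ht
    (Submodule.mem_of_mem_subsemiring h1 hrx))) (Q.mul_mem_of_mem_subsemiring (hT r hr) hneg)
  rwa [show q + t * (algebraMap ℝ A r + x) + algebraMap ℝ A r * -t = -1 by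
    linear_combination e] at h3

/-- The ideal of elements that are infinitesimal with respect to a module over an Archimedean
subsemiring. -/
def infinitesimalIdeal (hT : ∀ r : ℝ, 0 ≤ r → algebraMap ℝ A r ∈ T)
    (harch : ∀ a : A, ∃ r : ℝ, 0 ≤ r ∧ algebraMap ℝ A r + a ∈ T)
    (Q : Submodule T A) (h1 : (1 : A) ∈ Q) : Ideal A where
  carrier := {z | ∀ ε : ℝ, 0 < ε → algebraMap ℝ A ε + z ∈ Q ∧ algebraMap ℝ A ε - z ∈ Q}
  zero_mem' ε hε := by
    simpa using Submodule.mem_of_mem_subsemiring h1 (hT ε hε.le)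
  add_mem' {z w} hz hw ε hε := by
    obtain ⟨hz1, hz2⟩ := hz (ε / 2) (half_pos hε)
    obtain ⟨hw1, hw2⟩ := hw (ε / 2) (half_pos hε)
    have e : algebraMap ℝ A ε = algebraMap ℝ A (ε / 2) + algebraMap ℝ A (ε / 2) := by
      rw [← map_add, add_halves]
    constructor
    · convert Q.add_mem hz1 hw1 using 1
      rw [e]; ring
    · convert Q.add_mem hz2 hw2 using 1
      rw [e]; ring
  smul_mem' y z hz ε hε := by
    obtain ⟨k, hk, hky⟩ := harch y
    obtain ⟨l, hl, hly⟩ := harch (-y)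
    set δ : ℝ := ε / (2 * k + l + 1)
    have hδ : 0 < δ := by positivity
    have hδε : ε = δ * (2 * k + l) + δ := by
      simp only [δ]; field_simp
    obtain ⟨hz1, hz2⟩ := hz δ hδ
    have hu := Q.mul_mem_of_mem_subsemiring (hT δ hδ.le) (Submodule.mem_of_mem_subsemiring h1 hly)
    have hd := Submodule.mem_of_mem_subsemiring h1 (hT δ hδ.le)
    have e : algebraMap ℝ A ε = algebraMap ℝ A δ *
        (2 * algebraMap ℝ A k + algebraMap ℝ A l) + algebraMap ℝ A δ := by
      conv_lhs => rw [hδε]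
      simp only [map_add, map_mul, map_ofNat]
    rw [smul_eq_mul, e]
    constructor
    · convert Q.add_mem (Q.add_mem (Q.add_mem (Q.mul_mem_of_mem_subsemiring hky hz1) hu)
        (Q.mul_mem_of_mem_subsemiring (hT k hk) hz2)) hd using 1
      ring
    · convert Q.add_mem (Q.add_mem (Q.add_mem (Q.mul_mem_of_mem_subsemiring hky hz2) hu)
        (Q.mul_mem_of_mem_subsemiring (hT k hk) hz1)) hd using 1
      ring

/-- A real algebra in which every element is congruent to a unique real constant modulo an ideal
has a character with that ideal in its kernel. -/
theorem exists_algHom_of_existsUnique_sub_mem (I : Ideal A)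
    (h : ∀ x : A, ∃ c : ℝ, x - algebraMap ℝ A c ∈ I)
    (huniq : ∀ c : ℝ, algebraMap ℝ A c ∈ I → c = 0) :
    ∃ α : A →ₐ[ℝ] ℝ, ∀ x : A, x - algebraMap ℝ A (α x) ∈ I := by
  choose f hf using h
  have key : ∀ (x : A) (c : ℝ), x - algebraMap ℝ A c ∈ I → f x = c := by
    intro x c hc
    have := I.sub_mem hc (hf x)
    rw [show x - algebraMap ℝ A c - (x - algebraMap ℝ A (f x)) = algebraMap ℝ A (f x - c) by
      rw [map_sub]; ring] at this
    linarith [huniq _ this]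
  have hconst : ∀ r : ℝ, f (algebraMap ℝ A r) = r := fun r => key _ _ (by simp)
  refine ⟨{ toFun := f
            map_one' := by simpa using hconst 1
            map_zero' := by simpa using hconst 0
            map_add' := fun x y => key _ _ ?_
            map_mul' := fun x y => key _ _ ?_
            commutes' := hconst }, hf⟩
  · convert I.add_mem (I.mul_mem_left y (hf x))
      (I.mul_mem_left (algebraMap ℝ A (f x)) (hf y)) using 1
    rw [map_mul]; ring
  · convert I.add_mem (hf x) (hf y) using 1
    rw [map_add]; ring

theorem exists_algHom_nonneg_of_maximal (hT : ∀ r : ℝ, 0 ≤ r → algebraMap ℝ A r ∈ T)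
    (harch : ∀ a : A, ∃ r : ℝ, 0 ≤ r ∧ algebraMap ℝ A r + a ∈ T)
    {Q : Submodule T A} (h1 : (1 : A) ∈ Q) (hQ : (-1 : A) ∉ Q)
    (hmax : ∀ Q' : Submodule T A, Q ≤ Q' → (-1 : A) ∉ Q' → Q' ≤ Q) :
    ∃ α : A →ₐ[ℝ] ℝ, ∀ x ∈ Q, 0 ≤ α x := by
  have hex : ∀ x : A, ∃ c : ℝ, x - algebraMap ℝ A c ∈ infinitesimalIdeal hT harch Q h1 := by
    intro x
    set S : Set ℝ := {r | x - algebraMap ℝ A r ∈ Q}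
    have hne : S.Nonempty := by
      obtain ⟨r, -, hr⟩ := harch x
      refine ⟨-r, ?_⟩
      have := Submodule.mem_of_mem_subsemiring h1 hr
      simpa [S, add_comm] using this
    have hbdd : BddAbove S := by
      obtain ⟨r, -, hr⟩ := harch (-x)
      refine ⟨r, fun s hs => ?_⟩
      have h2 := Q.add_mem hs (Submodule.mem_of_mem_subsemiring h1 hr)
      rw [show x - algebraMap ℝ A s + (algebraMap ℝ A r + -x) = algebraMap ℝ A (r - s) by
        rw [map_sub]; ring] at h2
      linarith [nonneg_of_algebraMap_mem hT hQ h2]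
    refine ⟨sSup S, fun ε hε => ⟨?_, ?_⟩⟩
    · obtain ⟨r, hr, hlt⟩ := exists_lt_of_lt_csSup hne (sub_lt_self (sSup S) hε)
      convert Q.add_mem hr (Submodule.mem_of_mem_subsemiring h1
        (hT (r - (sSup S - ε)) (by linarith))) using 1
      simp only [map_sub]; ring
    · have hnot : x - algebraMap ℝ A (sSup S + ε) ∉ Q := fun h => by
        linarith [le_csSup hbdd h]
      convert (mem_or_neg_mem_of_maximal hT harch h1 hQ hmax _).resolve_left hnot using 1
      rw [map_add]; ring
  have huniq : ∀ c : ℝ, algebraMap ℝ A c ∈ infinitesimalIdeal hT harch Q h1 → c = 0 := by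
    intro c hc
    have hle : ∀ ε : ℝ, 0 < ε → 0 ≤ ε + c ∧ 0 ≤ ε - c := fun ε hε => by
      have h2 := hc ε hε
      rw [← map_add, ← map_sub] at h2
      exact ⟨nonneg_of_algebraMap_mem hT hQ h2.1, nonneg_of_algebraMap_mem hT hQ h2.2⟩
    apply le_antisymm
    · exact le_of_forall_pos_le_add fun ε hε => by linarith [(hle ε hε).2]
    · exact le_of_forall_pos_le_add fun ε hε => by linarith [(hle ε hε).1]
  obtain ⟨α, hα⟩ := exists_algHom_of_existsUnique_sub_mem _ hex huniq
  refine ⟨α, fun x hx => le_of_forall_pos_le_add fun ε hε => ?_⟩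
  have h2 := Q.add_mem hx (hα x ε hε).2
  rw [show x + (algebraMap ℝ A ε - (x - algebraMap ℝ A (α x))) = algebraMap ℝ A (α x + ε) by
    rw [map_add]; ring] at h2
  exact nonneg_of_algebraMap_mem hT hQ h2

theorem exists_algHom_nonneg_of_neg_one_notMem (hT : ∀ r : ℝ, 0 ≤ r → algebraMap ℝ A r ∈ T)
    (harch : ∀ a : A, ∃ r : ℝ, 0 ≤ r ∧ algebraMap ℝ A r + a ∈ T)
    {N : Submodule T A} (h1 : (1 : A) ∈ N) (hN : (-1 : A) ∉ N) :
    ∃ α : A →ₐ[ℝ] ℝ, ∀ x ∈ N, 0 ≤ α x := by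
  obtain ⟨Q, hNQ, hQ⟩ := zorn_le_nonempty₀ {Q : Submodule T A | (-1 : A) ∉ Q} (by
    intro c hc hchain y hy
    refine ⟨sSup c, fun h => ?_, fun z hz => le_sSup hz⟩
    obtain ⟨Q, hQc, hQ⟩ := (Submodule.mem_sSup_of_directed ⟨y, hy⟩ hchain.directedOn).1 h
    exact hc hQc hQ) N hN
  obtain ⟨α, hα⟩ := exists_algHom_nonneg_of_maximal hT harch (hNQ h1) hQ.prop
    fun Q' hle hQ' => hQ.le_of_ge hQ' hle
  exact ⟨α, fun x hx => hα x (hNQ hx)⟩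

theorem mem_of_mul_sub_one_mem (hT : ∀ r : ℝ, 0 ≤ r → algebraMap ℝ A r ∈ T)
    (harch : ∀ a : A, ∃ r : ℝ, 0 ≤ r ∧ algebraMap ℝ A r + a ∈ T)
    {N : Submodule T A} (h1 : (1 : A) ∈ N) {t a : A} (ht : t ∈ T) (hta : t * a - 1 ∈ N) :
    a ∈ N := by
  obtain ⟨k₀, hk₀, hkt₀⟩ := harch (-t)
  obtain ⟨k, hk, hkt⟩ : ∃ k : ℝ, 0 < k ∧ algebraMap ℝ A k + -t ∈ T := by
    refine ⟨k₀ + 1, by linarith, ?_⟩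
    convert T.add_mem hkt₀ T.one_mem using 1
    rw [map_add, map_one]; ring
  have step : ∀ r : ℝ, 0 ≤ r → algebraMap ℝ A r + a ∈ N →
      algebraMap ℝ A (r - k⁻¹) + a ∈ N := by
    intro r hr hra
    have h2 := N.mul_mem_of_mem_subsemiring (hT k⁻¹ (by positivity)) (N.add_mem (N.add_mem
      (N.mul_mem_of_mem_subsemiring hkt hra) hta)
      (N.mul_mem_of_mem_subsemiring (hT r hr) (Submodule.mem_of_mem_subsemiring h1 ht)))
    have hkk : algebraMap ℝ A k⁻¹ * algebraMap ℝ A k = 1 := by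
      rw [← map_mul, inv_mul_cancel₀ hk.ne', map_one]
    convert h2 using 1
    rw [map_sub]
    linear_combination (-(algebraMap ℝ A r) - a) * hkk
  have mono : ∀ r s : ℝ, r ≤ s → algebraMap ℝ A r + a ∈ N → algebraMap ℝ A s + a ∈ N := by
    intro r s hrs hr
    convert N.add_mem hr (Submodule.mem_of_mem_subsemiring h1 (hT (s - r) (by linarith))) using 1
    rw [map_sub]; ring
  obtain ⟨r, -, hr⟩ := harch a
  have iter : ∀ n : ℕ, algebraMap ℝ A (max (r - n * k⁻¹) 0) + a ∈ N := by
    intro n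
    induction n with
    | zero =>
      exact mono r _ (by simp) (Submodule.mem_of_mem_subsemiring h1 hr)
    | succ n ih =>
      refine mono _ _ ?_ (step _ (le_max_right _ _) ih)
      have hk' : 0 < k⁻¹ := by positivity
      push_cast
      rcases le_total (r - n * k⁻¹) 0 with h | h
      · rw [max_eq_right h]
        exact le_max_of_le_right (by linarith)
      · rw [max_eq_left h]
        exact le_max_of_le_left (by linarith)
  obtain ⟨n, hn⟩ := exists_nat_ge (r * k)
  have h3 := iter n
  rw [max_eq_right (by
    rw [← div_eq_mul_inv, sub_nonpos, le_div_iff₀ hk]; exact hn), map_zero, zero_add] at h3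
  exact h3

/-- The representation theorem for modules over an Archimedean subsemiring: an element outside
the module is nonpositive at some character that is nonnegative on the module. -/
theorem exists_algHom_nonneg_nonpos_of_notMem (hT : ∀ r : ℝ, 0 ≤ r → algebraMap ℝ A r ∈ T)
    (harch : ∀ a : A, ∃ r : ℝ, 0 ≤ r ∧ algebraMap ℝ A r + a ∈ T)
    {N : Submodule T A} (h1 : (1 : A) ∈ N) {a : A} (ha : a ∉ N) :
    ∃ α : A →ₐ[ℝ] ℝ, (∀ x ∈ N, 0 ≤ α x) ∧ α a ≤ 0 := by
  have hnot : (-1 : A) ∉ N ⊔ Submodule.span T {-a} := by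
    intro h
    obtain ⟨n, hn, z, hz, hnz⟩ := Submodule.mem_sup.1 h
    obtain ⟨t, rfl⟩ := Submodule.mem_span_singleton.1 hz
    have hnz' : n + (t : A) * -a = -1 := hnz
    refine ha (mem_of_mul_sub_one_mem hT harch h1 t.2 ?_)
    rwa [show (t : A) * a - 1 = n by linear_combination -hnz']
  obtain ⟨α, hα⟩ := exists_algHom_nonneg_of_neg_one_notMem hT harch
    ((le_sup_left : N ≤ N ⊔ Submodule.span T {-a}) h1) hnot
  refine ⟨α, fun x hx => hα x ((le_sup_left : N ≤ N ⊔ Submodule.span T {-a}) hx), ?_⟩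
  have := hα (-a) ((le_sup_right : _ ≤ N ⊔ Submodule.span T {-a})
    (Submodule.mem_span_singleton_self _))
  rw [map_neg] at this
  linarith

end ArchimedeanModule

section Seminorm

variable {A : Type*} [CommRing A] [Algebra ℝ A] {ρ : A → ℝ}

theorem IsSeminorm.map_zero (h : IsSeminorm ρ) : ρ 0 = 0 := by
  simpa using h.1 0 0

theorem IsSeminorm.map_neg (h : IsSeminorm ρ) (a : A) : ρ (-a) = ρ a := by
  simpa using h.1 (-1) a

theorem IsSeminorm.map_sub_rev (h : IsSeminorm ρ) (a b : A) : ρ (a - b) = ρ (b - a) := by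
  rw [← h.map_neg, neg_sub]

theorem IsSeminorm.nonneg (h : IsSeminorm ρ) (a : A) : 0 ≤ ρ a := by
  have := h.2 a (-a)
  rw [add_neg_cancel, h.map_zero, h.map_neg] at this
  linarith

theorem IsSeminorm.map_sub_le (h : IsSeminorm ρ) (a b c : A) :
    ρ (a - c) ≤ ρ (a - b) + ρ (b - c) := by
  simpa using h.2 (a - b) (b - c)

/-- The iteration `y ↦ (x + y ^ 2) / 2`, whose limit is `1 - √(1 - x)`. -/
noncomputable def sqrtIter (x : A) : ℕ → A
  | 0 => 0
  | n + 1 => (1 / 2 : ℝ) • (x + sqrtIter x n ^ 2)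

theorem IsSeminorm.sqrtIter_le (h : IsSeminorm ρ) (hmul : ∀ a b : A, ρ (a * b) ≤ ρ a * ρ b)
    {x : A} (hx : ρ x < 1) (n : ℕ) : ρ (sqrtIter x n) ≤ ρ x := by
  induction n with
  | zero => simpa [sqrtIter, h.map_zero] using h.nonneg x
  | succ n ih =>
    have h1 := h.2 x (sqrtIter x n ^ 2)
    have h2 := hmul (sqrtIter x n) (sqrtIter x n)
    rw [← pow_two] at h2
    rw [sqrtIter, h.1, abs_of_pos (by norm_num)]
    nlinarith [h.nonneg x, h.nonneg (sqrtIter x n)]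

theorem IsSeminorm.sqrtIter_succ_sub_le (h : IsSeminorm ρ)
    (hmul : ∀ a b : A, ρ (a * b) ≤ ρ a * ρ b) {x : A} (hx : ρ x < 1) (n : ℕ) :
    ρ (sqrtIter x (n + 1) - sqrtIter x n) ≤ ρ x ^ n * ρ (sqrtIter x 1) := by
  induction n with
  | zero => simp [sqrtIter]
  | succ n ih =>
    have e : sqrtIter x (n + 1 + 1) - sqrtIter x (n + 1) =
        (1 / 2 : ℝ) • ((sqrtIter x (n + 1) - sqrtIter x n) *
          (sqrtIter x (n + 1) + sqrtIter x n)) := by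
      have e1 : sqrtIter x (n + 1 + 1) = (1 / 2 : ℝ) • (x + sqrtIter x (n + 1) ^ 2) := rfl
      have e2 : sqrtIter x (n + 1) = (1 / 2 : ℝ) • (x + sqrtIter x n ^ 2) := rfl
      rw [e1]
      nth_rw 2 [e2]
      rw [← smul_sub]
      congr 1
      ring
    rw [e, h.1, abs_of_pos (by norm_num)]
    have h1 := hmul (sqrtIter x (n + 1) - sqrtIter x n) (sqrtIter x (n + 1) + sqrtIter x n)
    have h2 : ρ (sqrtIter x (n + 1) + sqrtIter x n) ≤ 2 * ρ x := by
      linarith [h.2 (sqrtIter x (n + 1)) (sqrtIter x n), h.sqrtIter_le hmul hx n,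
        h.sqrtIter_le hmul hx (n + 1)]
    have h3 := mul_le_mul ih h2 (h.nonneg _)
      (mul_nonneg (pow_nonneg (h.nonneg x) n) (h.nonneg _))
    rw [pow_succ]
    linarith

/-- If `ρ x < 1` then `1 - x` is a `ρ`-limit of squares. -/
theorem IsSeminorm.exists_sq_near_one_sub (h : IsSeminorm ρ)
    (hmul : ∀ a b : A, ρ (a * b) ≤ ρ a * ρ b) {x : A} (hx : ρ x < 1) {ε : ℝ} (hε : 0 < ε) :
    ∃ s : A, ρ (1 - x - s ^ 2) < ε := by
  have hlim : Filter.Tendsto (fun n : ℕ => 2 * (ρ x ^ n * ρ (sqrtIter x 1)))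
      Filter.atTop (nhds 0) := by
    simpa using ((tendsto_pow_atTop_nhds_zero_of_lt_one (h.nonneg x) hx).mul_const
      (ρ (sqrtIter x 1))).const_mul 2
  obtain ⟨n, hn⟩ := (hlim.eventually (gt_mem_nhds hε)).exists
  refine ⟨1 - sqrtIter x n, ?_⟩
  have e : 1 - x - (1 - sqrtIter x n) ^ 2 =
      (-2 : ℝ) • (sqrtIter x (n + 1) - sqrtIter x n) := by
    rw [sqrtIter, smul_sub, smul_smul, show (-2 : ℝ) * (1 / 2) = -1 by norm_num,
      Algebra.smul_def, Algebra.smul_def]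
    simp only [_root_.map_neg, map_one, map_ofNat]
    ring
  rw [e, h.1, show |(-2 : ℝ)| = 2 by norm_num]
  linarith [h.sqrtIter_succ_sub_le hmul hx n]

/-- The closure of a set with respect to a single seminorm. -/
def seminormClosure (ρ : A → ℝ) (M : Set A) : Set A :=
  {x | ∀ ε : ℝ, 0 < ε → ∃ m ∈ M, ρ (x - m) < ε}

theorem IsSeminorm.subset_seminormClosure (h : IsSeminorm ρ) (M : Set A) :
    M ⊆ seminormClosure ρ M := fun x hx ε hε => ⟨x, hx, by simpa [h.map_zero] using hε⟩

theorem IsSeminorm.mem_seminormClosure_of_near (h : IsSeminorm ρ) {M : Set A} {x : A}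
    (hx : ∀ ε : ℝ, 0 < ε → ∃ y ∈ seminormClosure ρ M, ρ (x - y) < ε) :
    x ∈ seminormClosure ρ M := by
  intro ε hε
  obtain ⟨y, hy, hxy⟩ := hx (ε / 2) (half_pos hε)
  obtain ⟨m, hm, hym⟩ := hy (ε / 2) (half_pos hε)
  exact ⟨m, hm, by linarith [h.map_sub_le x y m]⟩

theorem IsSeminorm.add_mem_seminormClosure (h : IsSeminorm ρ) {M : Set A}
    (hM : ∀ x ∈ M, ∀ y ∈ M, x + y ∈ M) {x y : A} (hx : x ∈ seminormClosure ρ M)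
    (hy : y ∈ seminormClosure ρ M) : x + y ∈ seminormClosure ρ M := by
  intro ε hε
  obtain ⟨m, hm, hxm⟩ := hx (ε / 2) (half_pos hε)
  obtain ⟨n, hn, hyn⟩ := hy (ε / 2) (half_pos hε)
  refine ⟨m + n, hM m hm n hn, ?_⟩
  have := h.2 (x - m) (y - n)
  rw [show x - m + (y - n) = x + y - (m + n) by ring] at this
  linarith

theorem IsSeminorm.mul_mem_seminormClosure (h : IsSeminorm ρ)
    (hmul : ∀ a b : A, ρ (a * b) ≤ ρ a * ρ b) {M : Set A} {a : A}
    (ha : ∀ m ∈ M, a * m ∈ M) {x : A} (hx : x ∈ seminormClosure ρ M) :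
    a * x ∈ seminormClosure ρ M := by
  intro ε hε
  have hpos : 0 < ρ a + 1 := by linarith [h.nonneg a]
  obtain ⟨m, hm, hxm⟩ := hx (ε / (ρ a + 1)) (by positivity)
  refine ⟨a * m, ha m hm, ?_⟩
  have h1 := hmul a (x - m)
  rw [mul_sub] at h1
  rw [lt_div_iff₀ hpos] at hxm
  nlinarith [h.nonneg (x - m)]

/-- The multipliers of the `ρ`-closure of a quadratic module. -/
def multiplierSubsemiring (h : IsSeminorm ρ) {M : Set A} (hM : IsQuadraticModule M) :
    Subsemiring A where
  carrier := {t | ∀ x ∈ seminormClosure ρ M, t * x ∈ seminormClosure ρ M}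
  zero_mem' x _ := by
    rw [zero_mul]
    exact h.subset_seminormClosure M hM.2.1
  one_mem' x hx := by rwa [one_mul]
  add_mem' {s t} hs ht x hx := by
    rw [add_mul]
    exact h.add_mem_seminormClosure hM.1.1 (hs x hx) (ht x hx)
  mul_mem' {s t} hs ht x hx := by
    rw [mul_assoc]
    exact hs _ (ht x hx)

/-- The `ρ`-closure of a quadratic module, as a module over its multipliers. -/
def closureSubmodule (h : IsSeminorm ρ) {M : Set A} (hM : IsQuadraticModule M) :
    Submodule (multiplierSubsemiring h hM) A where
  carrier := seminormClosure ρ M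
  zero_mem' := h.subset_seminormClosure M hM.2.1
  add_mem' := h.add_mem_seminormClosure hM.1.1
  smul_mem' t x hx := t.2 x hx

theorem algebraMap_mem_multiplierSubsemiring (h : IsSeminorm ρ)
    (hmul : ∀ a b : A, ρ (a * b) ≤ ρ a * ρ b) {M : Set A} (hM : IsQuadraticModule M)
    (r : ℝ) (hr : 0 ≤ r) : algebraMap ℝ A r ∈ multiplierSubsemiring h hM := fun x hx =>
  h.mul_mem_seminormClosure hmul
    (fun m hm => by simpa [Algebra.smul_def] using hM.1.2 r hr m hm) hx

theorem algebraMap_add_mem_multiplierSubsemiring (h : IsSeminorm ρ)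
    (hmul : ∀ a b : A, ρ (a * b) ≤ ρ a * ρ b) {M : Set A} (hM : IsQuadraticModule M)
    (a : A) {r : ℝ} (hr : ρ a < r) : algebraMap ℝ A r + a ∈ multiplierSubsemiring h hM := by
  have hr0 : 0 < r := (h.nonneg a).trans_lt hr
  have hone : 1 - (-r⁻¹ : ℝ) • a ∈ multiplierSubsemiring h hM := by
    intro x hx
    refine h.mem_seminormClosure_of_near fun ε hε => ?_
    have hpos : 0 < ρ x + 1 := by linarith [h.nonneg x]
    have hsmall : ρ ((-r⁻¹ : ℝ) • a) < 1 := by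
      rw [h.1, abs_neg, abs_of_pos (by positivity), inv_mul_lt_iff₀ hr0]
      linarith
    obtain ⟨s, hs⟩ := h.exists_sq_near_one_sub hmul hsmall (div_pos hε hpos)
    refine ⟨s ^ 2 * x, h.mul_mem_seminormClosure hmul (hM.2.2.2 s) hx, ?_⟩
    rw [← sub_mul]
    rw [lt_div_iff₀ hpos] at hs
    nlinarith [hmul (1 - (-r⁻¹ : ℝ) • a - s ^ 2) x, h.nonneg (1 - (-r⁻¹ : ℝ) • a - s ^ 2)]
  convert mul_mem (algebraMap_mem_multiplierSubsemiring h hmul hM r hr0.le) hone using 1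
  rw [mul_sub, ← Algebra.smul_def, ← Algebra.smul_def, smul_smul, mul_neg,
    mul_inv_cancel₀ hr0.ne', neg_one_smul, sub_neg_eq_add, Algebra.algebraMap_eq_smul_one]

/-- An element outside the `ρ`-closure of a quadratic module `M` is negative at some `ρ`-bounded
character that is nonnegative on `M`. -/
theorem exists_algHom_neg_of_notMem_seminormClosure (h : IsSeminorm ρ)
    (hmul : ∀ a b : A, ρ (a * b) ≤ ρ a * ρ b) {M : Set A} (hM : IsQuadraticModule M)
    {a : A} (ha : a ∉ seminormClosure ρ M) :
    ∃ α : A →ₐ[ℝ] ℝ, (∀ x, |α x| ≤ ρ x) ∧ (∀ m ∈ M, 0 ≤ α m) ∧ α a < 0 := by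
  obtain ⟨ε, hε, hε'⟩ : ∃ ε : ℝ, 0 < ε ∧ algebraMap ℝ A ε + a ∉ seminormClosure ρ M := by
    by_contra! hcon
    refine ha (h.mem_seminormClosure_of_near fun ε hε => ?_)
    have hpos : 0 < ρ 1 + 1 := by linarith [h.nonneg 1]
    refine ⟨_, hcon (ε / (ρ 1 + 1)) (by positivity), ?_⟩
    rw [sub_add_cancel_right, h.map_neg, Algebra.algebraMap_eq_smul_one, h.1,
      abs_of_pos (by positivity), div_mul_eq_mul_div, div_lt_iff₀ hpos]
    linarith
  have hone : (1 : A) ∈ closureSubmodule h hM := h.subset_seminormClosure M hM.2.2.1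
  obtain ⟨α, hα, hαa⟩ := exists_algHom_nonneg_nonpos_of_notMem (N := closureSubmodule h hM)
    (algebraMap_mem_multiplierSubsemiring h hmul hM)
    (fun b => ⟨ρ b + 1, by linarith [h.nonneg b],
      algebraMap_add_mem_multiplierSubsemiring h hmul hM b (by linarith)⟩)
    hone hε'
  have hlow : ∀ x, -α x ≤ ρ x := fun x => le_of_forall_pos_le_add fun δ hδ => by
    have := hα _ (Submodule.mem_of_mem_subsemiring hone
      (algebraMap_add_mem_multiplierSubsemiring h hmul hM x (lt_add_of_pos_right (ρ x) hδ)))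
    rw [map_add, α.commutes, Algebra.algebraMap_self_apply] at this
    linarith
  refine ⟨α, fun x => abs_le.2 ⟨by linarith [hlow x], ?_⟩,
    fun m hm => hα m (h.subset_seminormClosure M hm), ?_⟩
  · simpa [h.map_neg] using hlow (-x)
  · rw [map_add, α.commutes, Algebra.algebraMap_self_apply] at hαa
    linarith

theorem continuous_seminormTopology_of_abs_le {α : A →ₐ[ℝ] ℝ} (h : IsSeminorm ρ)
    (hα : ∀ x, |α x| ≤ ρ x) : @Continuous A ℝ (seminormTopology ρ) _ ⇑α := by
  let := seminormTopology ρ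
  refine continuous_def.2 fun V hV => isOpen_iff_forall_mem_open.2 fun x hx => ?_
  obtain ⟨ε, hε, hball⟩ := Metric.isOpen_iff.1 hV (α x) hx
  refine ⟨{y | ρ (y - x) < ε}, fun y hy => hball ?_,
    TopologicalSpace.isOpen_generateFrom_of_mem ⟨x, ε, hε, rfl⟩, by simpa [h.map_zero] using hε⟩
  rw [Metric.mem_ball, Real.dist_eq, ← map_sub]
  exact (hα _).trans_lt hy

/-- Open sets of the topology induced by a saturated family of seminorms contain balls around
each of their points. -/
theorem eq_univ_or_exists_ball_subset {ι : Type*} {F : ι → A → ℝ}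
    (hsem : ∀ i, IsSeminorm (F i))
    (hsat : ∀ i j, ∃ k, ∀ a : A, F k a = max (F i a) (F j a)) {U : Set A}
    (hU : @IsOpen A (⨅ i, seminormTopology (F i)) U) {x : A} (hx : x ∈ U) :
    U = Set.univ ∨ ∃ i, ∃ ε : ℝ, 0 < ε ∧ {y | F i (y - x) < ε} ⊆ U := by
  unfold seminormTopology at hU
  rw [← generateFrom_iUnion] at hU
  induction hU with
  | basic U hU =>
    obtain ⟨i, b, ε, -, rfl⟩ := Set.mem_iUnion.1 hU
    refine .inr ⟨i, ε - F i (x - b), sub_pos.2 hx, fun y hy => ?_⟩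
    have hy' : F i (y - x) < ε - F i (x - b) := hy
    change F i (y - b) < ε
    linarith [(hsem i).map_sub_le y x b]
  | univ => exact .inl rfl
  | inter U V _ _ hU hV =>
    rcases hU hx.1 with rfl | ⟨i, ε, hε, hi⟩
    · simpa using hV hx.2
    rcases hV hx.2 with rfl | ⟨j, δ, hδ, hj⟩
    · exact .inr ⟨i, ε, hε, by simpa using hi⟩
    obtain ⟨k, hk⟩ := hsat i j
    refine .inr ⟨k, min ε δ, lt_min hε hδ, fun y hy => ?_⟩
    have hy' : F k (y - x) < min ε δ := hy
    rw [hk, max_lt_iff, lt_min_iff, lt_min_iff] at hy'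
    exact ⟨hi hy'.1.1, hj hy'.2.2⟩
  | sUnion S _ ih =>
    obtain ⟨U, hUS, hxU⟩ := hx
    rcases ih U hUS hxU with rfl | ⟨i, ε, hε, hi⟩
    · exact .inl (Set.eq_univ_of_univ_subset (Set.subset_sUnion_of_mem hUS))
    · exact .inr ⟨i, ε, hε, hi.trans (Set.subset_sUnion_of_mem hUS)⟩

end Seminorm

/-- Let `F` be a saturated family of submultiplicative seminorms
on `A` (the pointwise max of two members again belongs to the family), let `τ` be
the locally convex topology induced by `F`, and let `M` be a quadratic module.
Then the `τ`-closure of `M` equals `Pos(Sp_τ(A) ∩ K(M))`. -/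
theorem closure_lmc_eq_pos {A : Type*} [CommRing A] [Algebra ℝ A]
    {ι : Type*} (F : ι → A → ℝ)
    (hsem : ∀ i, IsSeminorm (F i))
    (hsubmul : ∀ i, ∀ a b : A, F i (a * b) ≤ F i a * F i b)
    (hsat : ∀ i j, ∃ k, ∀ a : A, F k a = max (F i a) (F j a))
    (M : Set A) (hM : IsQuadraticModule M) :
    @closure A (⨅ i, seminormTopology (F i)) M
      = {a : A | ∀ α : A →ₐ[ℝ] ℝ,
          @Continuous A ℝ (⨅ i, seminormTopology (F i)) _ ⇑α →
          (∀ m ∈ M, 0 ≤ α m) → 0 ≤ α a} := by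
  let _ : TopologicalSpace A := ⨅ i, seminormTopology (F i)
  apply Set.Subset.antisymm
  · intro a ha α hα hpos
    exact closure_minimal (t := α ⁻¹' Set.Ici 0) hpos (isClosed_Ici.preimage hα) ha
  · intro a ha
    refine mem_closure_iff.2 fun U hU haU => ?_
    rcases eq_univ_or_exists_ball_subset hsem hsat hU haU with rfl | ⟨i, ε, hε, hball⟩
    · exact ⟨1, trivial, hM.2.2.1⟩
    have hmem : a ∈ seminormClosure (F i) M := by
      by_contra hnot
      obtain ⟨α, hbound, hpos, hneg⟩ :=
        exists_algHom_neg_of_notMem_seminormClosure (hsem i) (hsubmul i) hM hnot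
      have hcont := continuous_le_dom (iInf_le (fun i => seminormTopology (F i)) i)
        (continuous_seminormTopology_of_abs_le (hsem i) hbound)
      exact absurd (ha α hcont hpos) hneg.not_ge
    obtain ⟨m, hm, ham⟩ := hmem ε hε
    exact ⟨m, hball (by rwa [Set.mem_ofPred_eq, (hsem i).map_sub_rev]), hm⟩
end

section
/- Let M be a proper Archimedean quadratic module of A and define ‖a‖_M = inf{r ∈ ℝ : r+a ∈ M and r−a ∈ M}. Then ‖·‖_M is a submultiplicative seminorm on A: for all a, b ∈ A and λ ∈ ℝ one has ‖a‖_M ≥ 0, ‖λa‖_M = |λ|·‖a‖_M, ‖a+b‖_M ≤ ‖a‖_M + ‖b‖_M, and ‖ab‖_M ≤ ‖a‖_M·‖b‖_M. -/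
/-- The set of radii whose infimum is `mNorm M a`. -/
def mBounds {A : Type*} [CommRing A] [Algebra ℝ A] (M : Set A) (a : A) : Set ℝ :=
  {r : ℝ | algebraMap ℝ A r + a ∈ M ∧ algebraMap ℝ A r - a ∈ M}

section

variable {A : Type*} [CommRing A] [Algebra ℝ A] {M : Set A} {a b : A} {r s : ℝ}

theorem IsQuadraticModule.algebraMap_mem (hM : IsQuadraticModule M) (hr : 0 ≤ r) :
    algebraMap ℝ A r ∈ M := by
  rw [Algebra.algebraMap_eq_smul_one]
  exact hM.1.2 r hr 1 hM.2.2.1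

theorem IsQuadraticModule.sq_mem (hM : IsQuadraticModule M) (a : A) : a ^ 2 ∈ M := by
  simpa using hM.2.2.2 a 1 hM.2.2.1

theorem IsQuadraticModule.mem_of_algebraMap_mul_mem (hM : IsQuadraticModule M) (hr : 0 < r)
    (h : algebraMap ℝ A r * a ∈ M) : a ∈ M := by
  rw [← Algebra.smul_def] at h
  simpa [smul_smul, hr.ne'] using hM.1.2 r⁻¹ (inv_nonneg.2 hr.le) _ h

theorem mBounds_mono (hM : IsQuadraticModule M) (hr : r ∈ mBounds M a) (h : r ≤ s) :
    s ∈ mBounds M a := by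
  have hd := hM.algebraMap_mem (sub_nonneg.2 h)
  constructor
  · convert hM.1.1 _ hd _ hr.1 using 1
    rw [map_sub]; ring
  · convert hM.1.1 _ hd _ hr.2 using 1
    rw [map_sub]; ring

theorem nonneg_of_mem_mBounds (hM : IsQuadraticModule M) (hproper : (-1 : A) ∉ M)
    (hr : r ∈ mBounds M a) : 0 ≤ r := by
  by_contra! h
  refine hproper (hM.mem_of_algebraMap_mul_mem (r := -(2 * r)) (by linarith) ?_)
  convert hM.1.1 _ hr.1 _ hr.2 using 1
  rw [map_neg, map_mul, map_ofNat]; ring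

theorem add_mem_mBounds (hM : IsQuadraticModule M) (hr : r ∈ mBounds M a)
    (hs : s ∈ mBounds M b) : r + s ∈ mBounds M (a + b) := by
  constructor
  · convert hM.1.1 _ hr.1 _ hs.1 using 1
    rw [map_add]; ring
  · convert hM.1.1 _ hr.2 _ hs.2 using 1
    rw [map_add]; ring

theorem neg_mem_mBounds (hr : r ∈ mBounds M a) : r ∈ mBounds M (-a) :=
  ⟨by simpa [sub_eq_add_neg] using hr.2, by simpa using hr.1⟩

theorem smul_mem_mBounds (hM : IsQuadraticModule M) (l : ℝ) (hr : r ∈ mBounds M a) :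
    |l| * r ∈ mBounds M (l • a) := by
  have key : |l| * r ∈ mBounds M (|l| • a) := by
    constructor
    · convert hM.1.2 _ (abs_nonneg l) _ hr.1 using 1
      simp [Algebra.smul_def, mul_add]
    · convert hM.1.2 _ (abs_nonneg l) _ hr.2 using 1
      simp [Algebra.smul_def, mul_sub]
  rcases abs_choice l with h | h
  · rwa [h] at key ⊢
  · simpa [h] using neg_mem_mBounds key

theorem sq_sub_sq_mem (hM : IsQuadraticModule M) (hr0 : 0 < r) (hr : r ∈ mBounds M a) :
    algebraMap ℝ A r ^ 2 - a ^ 2 ∈ M := by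
  refine hM.mem_of_algebraMap_mul_mem (r := 2 * r) (by positivity) ?_
  convert hM.1.1 _ (hM.2.2.2 (algebraMap ℝ A r - a) _ hr.1)
    _ (hM.2.2.2 (algebraMap ℝ A r + a) _ hr.2) using 1
  rw [map_mul, map_ofNat]; ring

/-- Polarization (`4 * u * v` is `(u + v) ^ 2 - (u - v) ^ 2`) reduces products to squares. -/
theorem algebraMap_mul_sub_mul_mem (hM : IsQuadraticModule M) (hr0 : 0 < r) (hs0 : 0 < s)
    (hr : r ∈ mBounds M a) (hs : s ∈ mBounds M b) :
    algebraMap ℝ A (r * s) - a * b ∈ M := by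
  have h := add_mem_mBounds hM (smul_mem_mBounds hM s hr) (smul_mem_mBounds hM r hs)
  rw [abs_of_pos hr0, abs_of_pos hs0] at h
  refine hM.mem_of_algebraMap_mul_mem (r := 4 * (r * s)) (by positivity) ?_
  convert hM.1.1 _ (sq_sub_sq_mem hM (by positivity) h) _ (hM.sq_mem (s • a - r • b)) using 1
  simp only [Algebra.smul_def, map_mul, map_add, map_ofNat]; ring

theorem mul_mem_mBounds (hM : IsQuadraticModule M) (hr0 : 0 < r) (hs0 : 0 < s)
    (hr : r ∈ mBounds M a) (hs : s ∈ mBounds M b) : r * s ∈ mBounds M (a * b) := by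
  refine ⟨?_, algebraMap_mul_sub_mul_mem hM hr0 hs0 hr hs⟩
  simpa using algebraMap_mul_sub_mul_mem hM hr0 hs0 (neg_mem_mBounds hr) hs

theorem mNorm_nonneg (hM : IsQuadraticModule M) (hproper : (-1 : A) ∉ M) (a : A) :
    0 ≤ mNorm M a :=
  Real.sInf_nonneg fun _ hr => nonneg_of_mem_mBounds hM hproper hr

theorem mNorm_le (hM : IsQuadraticModule M) (hproper : (-1 : A) ∉ M) (hr : r ∈ mBounds M a) :
    mNorm M a ≤ r :=
  csInf_le ⟨0, fun _ hs => nonneg_of_mem_mBounds hM hproper hs⟩ hr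

theorem mem_mBounds_of_mNorm_lt (hM : IsQuadraticModule M) (harch : IsArchimedeanCone M)
    (h : mNorm M a < r) : r ∈ mBounds M a := by
  obtain ⟨t, -, ht⟩ := harch a
  obtain ⟨s, hs, hsr⟩ := exists_lt_of_csInf_lt ⟨t, ht⟩ h
  exact mBounds_mono hM hs hsr.le

theorem mNorm_smul_le (hM : IsQuadraticModule M) (harch : IsArchimedeanCone M)
    (hproper : (-1 : A) ∉ M) (l : ℝ) (a : A) : mNorm M (l • a) ≤ |l| * mNorm M a := by
  have h : Filter.Tendsto (fun r => |l| * r) (nhdsWithin (mNorm M a) (Set.Ioi (mNorm M a)))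
      (nhds (|l| * mNorm M a)) :=
    ((continuous_const.mul continuous_id).tendsto _).mono_left nhdsWithin_le_nhds
  refine ge_of_tendsto h ?_
  filter_upwards [self_mem_nhdsWithin] with r hr
  exact mNorm_le hM hproper (smul_mem_mBounds hM l (mem_mBounds_of_mNorm_lt hM harch hr))

end

/-- For a proper Archimedean quadratic module `M`, the function
`‖·‖_M` is a submultiplicative seminorm on `A`: it is nonnegative, absolutely
homogeneous, subadditive, and submultiplicative. -/
theorem mNorm_is_submultiplicative_seminorm {A : Type*} [CommRing A] [Algebra ℝ A]
    (M : Set A) (hM : IsQuadraticModule M) (harch : IsArchimedeanCone M)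
    (hproper : (-1 : A) ∉ M) :
    (∀ a : A, 0 ≤ mNorm M a)
    ∧ (∀ (l : ℝ) (a : A), mNorm M (l • a) = |l| * mNorm M a)
    ∧ (∀ a b : A, mNorm M (a + b) ≤ mNorm M a + mNorm M b)
    ∧ (∀ a b : A, mNorm M (a * b) ≤ mNorm M a * mNorm M b) := by
  refine ⟨mNorm_nonneg hM hproper, fun l a => ?_, fun a b => ?_, fun a b => ?_⟩
  · refine (mNorm_smul_le hM harch hproper l a).antisymm ?_
    rcases eq_or_ne l 0 with rfl | hl
    · simpa using mNorm_nonneg hM hproper (0 : A)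
    · have h := mNorm_smul_le hM harch hproper l⁻¹ (l • a)
      rwa [inv_smul_smul₀ hl, abs_inv, inv_mul_eq_div, le_div_iff₀' (abs_pos.2 hl)] at h
  · refine le_of_forall_pos_le_add fun ε hε => ?_
    have ha := mem_mBounds_of_mNorm_lt hM harch (lt_add_of_pos_right (mNorm M a) (half_pos hε))
    have hb := mem_mBounds_of_mNorm_lt hM harch (lt_add_of_pos_right (mNorm M b) (half_pos hε))
    linarith [mNorm_le hM hproper (add_mem_mBounds hM ha hb)]
  · refine le_mul_of_forall_lt₀ fun r hr s hs => ?_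
    exact mNorm_le hM hproper (mul_mem_mBounds hM
      ((mNorm_nonneg hM hproper a).trans_lt hr) ((mNorm_nonneg hM hproper b).trans_lt hs)
      (mem_mBounds_of_mNorm_lt hM harch hr) (mem_mBounds_of_mNorm_lt hM harch hs))
end

section
/- Let M be a proper Archimedean quadratic module of A and let L : A → ℝ be a linear functional with L(M) ⊆ [0, ∞). Then |L(a)| ≤ L(1)·‖a‖_M for every a ∈ A; in particular L is continuous with respect to the topology induced by the seminorm ‖·‖_M. -/
theorem mNorm_zero {A : Type*} [CommRing A] [Algebra ℝ A] {M : Set A}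
    (hM : IsQuadraticModule M) (hproper : (-1 : A) ∉ M) : mNorm M 0 = 0 := by
  obtain ⟨⟨-, hsmul⟩, hzero, -, -⟩ := hM
  refine IsLeast.csInf_eq ⟨by simpa using hzero, fun r hr => ?_⟩
  by_contra! hneg
  apply hproper
  have hmem := hsmul (-r)⁻¹ (inv_nonneg.2 (neg_nonneg.2 hneg.le)) _ hr.1
  rwa [add_zero, Algebra.algebraMap_eq_smul_one, smul_smul, inv_neg, neg_mul,
    inv_mul_cancel₀ hneg.ne, neg_smul, one_smul] at hmem

theorem abs_le_mul_mNorm {A : Type*} [CommRing A] [Algebra ℝ A] {M : Set A}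
    (hone : (1 : A) ∈ M) (harch : IsArchimedeanCone M)
    (L : A →ₗ[ℝ] ℝ) (hL : ∀ m ∈ M, 0 ≤ L m) (a : A) : |L a| ≤ L 1 * mNorm M a := by
  have hbound : ∀ r : ℝ, algebraMap ℝ A r + a ∈ M ∧ algebraMap ℝ A r - a ∈ M →
      |L a| ≤ L 1 * r := by
    rintro r ⟨hadd, hsub⟩
    have h₁ := hL _ hadd
    have h₂ := hL _ hsub
    rw [Algebra.algebraMap_eq_smul_one, map_add, map_smul, smul_eq_mul] at h₁
    rw [Algebra.algebraMap_eq_smul_one, map_sub, map_smul, smul_eq_mul] at h₂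
    exact abs_le.2 ⟨by linarith, by linarith⟩
  obtain ⟨r, -, hr⟩ := harch a
  rcases (hL 1 hone).eq_or_lt with h | h
  · simpa [← h] using hbound r hr
  · rw [← div_le_iff₀' h]
    exact le_csInf ⟨r, hr⟩ fun s hs => (div_le_iff₀' h).2 (hbound s hs)

theorem continuous_seminormTopology_of_abs_le_s7 {A : Type*} [CommRing A] [Algebra ℝ A]
    {ρ : A → ℝ} (hρ : ρ 0 = 0) (L : A →ₗ[ℝ] ℝ) {c : ℝ} (hc : 0 ≤ c)
    (hL : ∀ a, |L a| ≤ c * ρ a) : @Continuous A ℝ (seminormTopology ρ) _ ⇑L := by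
  let _ := seminormTopology ρ
  refine ⟨fun U hU => isOpen_iff_forall_mem_open.2 fun x hx => ?_⟩
  obtain ⟨ε, hε, hball⟩ := Metric.isOpen_iff.1 hU (L x) hx
  have hδ : 0 < ε / (c + 1) := by positivity
  refine ⟨{y | ρ (y - x) < ε / (c + 1)}, fun y hy => hball ?_,
    TopologicalSpace.isOpen_generateFrom_of_mem ⟨x, _, hδ, rfl⟩, by simpa [hρ] using hδ⟩
  rw [Metric.mem_ball, Real.dist_eq, ← map_sub]
  calc |L (y - x)| ≤ c * ρ (y - x) := hL _
    _ ≤ c * (ε / (c + 1)) := mul_le_mul_of_nonneg_left (le_of_lt hy) hc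
    _ < (c + 1) * (ε / (c + 1)) := mul_lt_mul_of_pos_right (lt_add_one c) hδ
    _ = ε := mul_div_cancel₀ ε (by positivity)

/-- If `M` is a proper Archimedean quadratic module and
`L : A → ℝ` is a linear functional with `L(M) ⊆ [0, ∞)`, then
`|L(a)| ≤ L(1)·‖a‖_M` for all `a`; in particular `L` is continuous for the
`‖·‖_M`-topology. -/
theorem nonneg_functional_mNorm_continuous {A : Type*} [CommRing A] [Algebra ℝ A]
    (M : Set A) (hM : IsQuadraticModule M) (harch : IsArchimedeanCone M)
    (hproper : (-1 : A) ∉ M)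
    (L : A →ₗ[ℝ] ℝ) (hL : ∀ m ∈ M, 0 ≤ L m) :
    (∀ a : A, |L a| ≤ L 1 * mNorm M a)
    ∧ @Continuous A ℝ (seminormTopology (mNorm M)) _ ⇑L :=
  have hbound := abs_le_mul_mNorm hM.2.2.1 harch L hL
  ⟨hbound, continuous_seminormTopology_of_abs_le_s7 (mNorm_zero hM hproper) L
    (hL 1 hM.2.2.1) hbound⟩
end

section
/- Let M be a quadratic module of A. Then the union of K(T), taken over all proper Archimedean quadratic modules T of A with M ⊆ T, equals K(M). -/
/-- For a quadratic module `M` of `A`, the union of `K(T)`,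
over all proper Archimedean quadratic modules `T` of `A` containing `M`,
equals `K(M)`. -/
theorem union_KT_eq_KM {A : Type*} [CommRing A] [Algebra ℝ A]
    (M : Set A) (hM : IsQuadraticModule M) :
    (⋃ T ∈ {T : Set A | IsQuadraticModule T ∧ IsArchimedeanCone T
        ∧ (-1 : A) ∉ T ∧ M ⊆ T},
      {α : A →ₐ[ℝ] ℝ | ∀ t ∈ T, 0 ≤ α t})
      = {α : A →ₐ[ℝ] ℝ | ∀ m ∈ M, 0 ≤ α m} := by
  ext α
  simp only [Set.mem_iUnion, Set.mem_ofPred_eq, exists_prop]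
  constructor
  · rintro ⟨T, ⟨-, -, -, hMT⟩, hα⟩ m hm
    exact hα m (hMT hm)
  · intro hα
    refine ⟨{a | 0 ≤ α a}, ⟨⟨⟨?_, ?_⟩, ?_, ?_, ?_⟩, ?_, ?_, hα⟩, fun _ ht => ht⟩
    · intro x hx y hy
      simpa using add_nonneg hx hy
    · intro r hr x hx
      simpa using mul_nonneg hr hx
    · simp
    · simp
    · intro a m hm
      simpa using mul_nonneg (sq_nonneg (α a)) hm
    · intro a
      refine ⟨|α a|, abs_nonneg _, ?_, ?_⟩
      · simpa [neg_le_iff_add_nonneg'] using neg_abs_le (α a)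
      · simpa using le_abs_self (α a)
    · simp
end
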